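/- arXiv:1604.04600 — 7 statements merged into one kernel-verified Lean document; each statement's English description precedes it below -/
import Mathlib

section
/- For every m×m Hermitian matrix Z, the projection π_{S_m}(Z) of Z onto the set S_m of density matrices with respect to the Hilbert–Schmidt norm is also a closest density matrix to Z in the operator norm: ‖Z − π_{S_m}(Z)‖_∞ = inf_{S ∈ S_m} ‖Z − S‖_∞. -/
open scoped BigOperators ENNReal
open MeasureTheory ProbabilityTheory Matrix
open scoped ComplexOrder

noncomputable section

abbrev Mat (m : ℕ) := Matrix (Fin m) (Fin m) ℂ

namespace QST

variable {m : ℕ}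

/-- Hilbert–Schmidt (Frobenius) norm `‖A‖₂`. -/
def frob (A : Mat m) : ℝ := Real.sqrt (∑ i, ∑ j, ‖A i j‖ ^ 2)

/-- Hilbert–Schmidt inner product `⟨A,B⟩ = Re tr(A B*)`. -/
def hsInner (A B : Mat m) : ℝ := (Matrix.trace (A * Bᴴ)).re

/-- Eigenvalues of a Hermitian matrix (junk value `0` otherwise). -/
def eigs (A : Mat m) : Fin m → ℝ :=
  if h : A.IsHermitian then h.eigenvalues else 0

/-- Operator (spectral) norm of a Hermitian matrix: the largest absolute value
of an eigenvalue. -/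
def opNorm (A : Mat m) : ℝ := ⨆ i, |eigs A i|

/-- Schatten `p`-norm, `p ∈ [1,∞]`. -/
def schatten (p : ℝ≥0∞) (A : Mat m) : ℝ :=
  if p = ∞ then opNorm A
  else (∑ i, |eigs A i| ^ p.toReal) ^ (1 / p.toReal)

/-- A density matrix: positive semidefinite (hence Hermitian) with unit trace. -/
def IsDensity (A : Mat m) : Prop := A.PosSemidef ∧ A.trace = 1

/-- The set `𝒮_m` of density matrices. -/
def Densities (m : ℕ) : Set (Mat m) := {A | IsDensity A}

/-- The set `𝒮_{m,δ} = {(1-δ) S + δ I/m : S ∈ 𝒮_m}`. -/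
def DensitiesReg (m : ℕ) (δ : ℝ) : Set (Mat m) :=
  {A | ∃ S, IsDensity S ∧ A = (1 - δ) • S + (δ / m) • (1 : Mat m)}

/-- `P` is the Hilbert–Schmidt projection of `Z` onto the set `C`. -/
def IsProjOn (C : Set (Mat m)) (Z P : Mat m) : Prop :=
  P ∈ C ∧ ∀ S ∈ C, frob (Z - P) ≤ frob (Z - S)

/-- Functional calculus for Hermitian matrices via the spectral decomposition
(junk value `0` for non-Hermitian matrices). -/
def hermApply (f : ℝ → ℝ) (A : Mat m) : Mat m :=
  if h : A.IsHermitian then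
    (h.eigenvectorUnitary : Mat m) *
      Matrix.diagonal (fun i => (f (h.eigenvalues i) : ℂ)) *
        (star (h.eigenvectorUnitary : Mat m))
  else 0

/-- Quantum relative entropy `K(S₁‖S₂) = tr(S₁ log S₁ - S₁ log S₂)`; the convention
`0 log 0 = 0` is automatic since `Real.log 0 = 0`. -/
def relEntropy (S₁ S₂ : Mat m) : ℝ :=
  (Matrix.trace (S₁ * hermApply Real.log S₁ - S₁ * hermApply Real.log S₂)).re

/-- Squared Bures distance `H²(S₁,S₂) = 2 - 2 tr √(√S₁ S₂ √S₁)`. -/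
def bures2 (S₁ S₂ : Mat m) : ℝ :=
  2 - 2 * (Matrix.trace (hermApply Real.sqrt
      (hermApply Real.sqrt S₁ * S₂ * hermApply Real.sqrt S₁))).re

/-- The probability simplex `Δ_m ⊂ ℝ^m`. -/
def simplex (m : ℕ) : Set (Fin m → ℝ) := {u | (∀ j, 0 ≤ u j) ∧ ∑ j, u j = 1}

/-- Euclidean norm on `ℝ^m`. -/
def e2 (x : Fin m → ℝ) : ℝ := Real.sqrt (∑ j, x j ^ 2)

/-- Supremum norm on `ℝ^m`. -/
def linf (x : Fin m → ℝ) : ℝ := ⨆ j, |x j|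

/-- `v` is the Euclidean projection of `z` onto the simplex `Δ_m`. -/
def IsProjSimplex (z v : Fin m → ℝ) : Prop :=
  v ∈ simplex m ∧ ∀ u ∈ simplex m, e2 (z - v) ≤ e2 (z - u)

/-- `E` is an orthonormal basis of the `m²`-dimensional real inner product space `ℍ_m`
of Hermitian `m×m` matrices (an orthonormal family of `m²` Hermitian matrices is
automatically a basis). -/
def IsONBasis (E : Fin (m ^ 2) → Mat m) : Prop :=
  (∀ k, (E k).IsHermitian) ∧
    ∀ k l, (Matrix.trace (E k * (E l)ᴴ)).re = if k = l then 1 else 0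


/-- The maximal deviation estimate behind the comparison of the two norms: the vector `μ` attains
its maximum wherever `p` is supported. -/
lemma abs_le_of_isMaxOn_support {ι : Type*} [Fintype ι] {μ p s : ι → ℝ} {N : ℝ}
    (hp : ∀ i, 0 ≤ p i) (hp1 : ∑ i, p i = 1) (hs : ∀ i, 0 ≤ s i) (hs1 : ∑ i, s i = 1)
    (hμ : ∀ i, μ i ≤ ∑ j, μ j * p j) (hN : ∀ i, |μ i + p i - s i| ≤ N) (i : ι) :
    |μ i| ≤ N := by
  classical
  set c := ∑ j, μ j * p j with hc
  have hslack : ∑ j, (c - μ j) * p j = 0 := by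
    simp only [sub_mul, Finset.sum_sub_distrib, ← Finset.mul_sum, hp1, ← hc]
    ring
  have hsupp : ∀ j, μ j ≠ c → p j = 0 := fun j hj =>
    (mul_eq_zero.1 ((Finset.sum_eq_zero_iff_of_nonneg fun k _ =>
      mul_nonneg (sub_nonneg.2 (hμ k)) (hp k)).1 hslack j (Finset.mem_univ j))).resolve_left
      (sub_ne_zero.2 hj.symm)
  have hlow : ∀ j, μ j ≠ c → -N ≤ μ j := fun j hj => by
    have h1 := (abs_le.1 (hN j)).1
    have h2 := hs j
    rw [hsupp j hj] at h1
    linarith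
  have hup : c ≤ N := by
    set K := Finset.univ.filter fun j => μ j = c with hK
    have hpK : ∑ j ∈ K, p j = 1 := by
      rw [← hp1]
      refine Finset.sum_subset (Finset.subset_univ _) fun j _ hj => hsupp j ?_
      simpa [hK] using hj
    have hsK : ∑ j ∈ K, s j ≤ ∑ j ∈ K, p j := by
      rw [hpK, ← hs1]
      exact Finset.sum_le_sum_of_subset_of_nonneg (Finset.subset_univ _) fun j _ _ => hs j
    have hne : K.Nonempty := by
      rw [Finset.nonempty_iff_ne_empty]
      intro h
      simp [h] at hpK
    obtain ⟨j, hj, hle⟩ := Finset.exists_le_of_sum_le hne hsK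
    have hjc : μ j = c := by simpa [hK] using hj
    have := (abs_le.1 (hN j)).2
    linarith
  have hc_low : -N ≤ c := by
    by_cases h : ∃ j, μ j ≠ c
    · obtain ⟨j, hj⟩ := h
      exact (hlow j hj).trans (hμ j)
    · push Not at h
      obtain ⟨j, -, hle⟩ := Finset.exists_le_of_sum_le (s := Finset.univ) ⟨i, Finset.mem_univ i⟩
        (hp1.trans hs1.symm).le
      have := (abs_le.1 (hN j)).1
      have := h j
      linarith
  refine abs_le.2 ⟨?_, (hμ i).trans hup⟩
  by_cases h : μ i = c
  · exact h ▸ hc_low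
  · exact hlow i h

lemma re_trace_mul_conjTranspose (A : Mat m) :
    (A * Aᴴ).trace.re = ∑ i, ∑ j, ‖A i j‖ ^ 2 := by
  simp only [trace, diag_apply, mul_apply, conjTranspose_apply, Complex.re_sum, RCLike.star_def,
    Complex.mul_conj, Complex.ofReal_re, Complex.normSq_eq_norm_sq]

lemma abs_eigenvalues_le_opNorm {A : Mat m} (hA : A.IsHermitian) (i : Fin m) :
    |hA.eigenvalues i| ≤ opNorm A := by
  have := le_ciSup (f := fun i => |eigs A i|) (Set.finite_range _).bddAbove i
  simpa [opNorm, eigs, hA] using this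

lemma posSemidef_smul_one_add_smul {A : Mat m} (hA : A.IsHermitian) (a b : ℝ)
    (h : ∀ i, 0 ≤ a + b * hA.eigenvalues i) : ((a : ℂ) • (1 : Mat m) + (b : ℂ) • A).PosSemidef := by
  have hd : (diagonal fun i => ((a + b * hA.eigenvalues i : ℝ) : ℂ)).PosSemidef :=
    PosSemidef.diagonal fun i => by simpa using mod_cast h i
  have := hd.mul_mul_conjTranspose_same (hA.eigenvectorUnitary : Mat m)
  convert this using 1
  have hdiag : (diagonal fun i => ((a + b * hA.eigenvalues i : ℝ) : ℂ)) =
      (a : ℂ) • (1 : Mat m) + (b : ℂ) • diagonal (RCLike.ofReal ∘ hA.eigenvalues) := by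
    ext i j
    by_cases hij : i = j <;> simp [one_apply, hij]
  have hspec := hA.spectral_theorem
  rw [Unitary.conjStarAlgAut_apply] at hspec
  have hU : (hA.eigenvectorUnitary : Mat m) * (hA.eigenvectorUnitary : Mat m)ᴴ = 1 :=
    Unitary.coe_mul_star_self _
  rw [hdiag]
  simp only [mul_add, add_mul, mul_smul_comm, smul_mul_assoc, mul_one, hU]
  congr 2

lemma abs_re_conj_apply_le_opNorm {A : Mat m} (hA : A.IsHermitian) {U : Mat m}
    (hU : Uᴴ * U = 1) (i : Fin m) : |((Uᴴ * A * U) i i).re| ≤ opNorm A := by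
  have key : ∀ b : ℝ, |b| = 1 → 0 ≤ opNorm A + b * ((Uᴴ * A * U) i i).re := fun b hb => by
    have hpos := (posSemidef_smul_one_add_smul hA (opNorm A) b fun j => by
      have h1 := abs_eigenvalues_le_opNorm hA j
      have h2 := neg_abs_le (b * hA.eigenvalues j)
      rw [abs_mul, hb, one_mul] at h2
      linarith).conjTranspose_mul_mul_same U
    have := (Complex.le_def.1 (hpos.diag_nonneg (i := i))).1
    simpa [mul_add, add_mul, hU] using this
  have h1 := key 1 (by simp)
  have h2 := key (-1) (by simp)
  exact abs_le.2 ⟨by linarith, by linarith⟩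

lemma convex_densities : Convex ℝ (Densities m) := by
  rintro A ⟨hA, hA1⟩ B ⟨hB, hB1⟩ a b ha hb hab
  refine ⟨(hA.smul ha).add (hB.smul hb), ?_⟩
  rw [trace_add, trace_smul, trace_smul, hA1, hB1, ← add_smul, hab, one_smul]

lemma IsDensity.conj {A U : Mat m} (hA : IsDensity A) (hU : U * Uᴴ = 1) :
    IsDensity (Uᴴ * A * U) :=
  ⟨hA.1.conjTranspose_mul_mul_same U, by rw [trace_mul_cycle, hU, one_mul, hA.2]⟩

lemma isDensity_single (i : Fin m) : IsDensity (diagonal (Pi.single i (1 : ℂ))) :=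
  ⟨PosSemidef.diagonal (Pi.single_nonneg.2 zero_le_one), by simp [trace_diagonal]⟩

lemma IsDensity.diag_re_nonneg {A : Mat m} (hA : IsDensity A) (i : Fin m) : 0 ≤ (A i i).re :=
  (Complex.le_def.1 (hA.1.diag_nonneg (i := i))).1

lemma IsDensity.sum_diag_re {A : Mat m} (hA : IsDensity A) : ∑ i, (A i i).re = 1 := by
  simpa [trace] using congrArg Complex.re hA.2

/-- The variational inequality characterising the Hilbert–Schmidt projection. -/
lemma IsProjOn.re_trace_mul_le {C : Set (Mat m)} (hC : Convex ℝ C) {Z P S : Mat m}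
    (hP : IsProjOn C Z P) (hS : S ∈ C) (hR : (Z - P).IsHermitian) (hD : (S - P).IsHermitian) :
    ((Z - P) * S).trace.re ≤ ((Z - P) * P).trace.re := by
  set R := Z - P with hRdef
  set D := S - P with hDdef
  have hexp : ∀ t : ℝ, 0 < t → t ≤ 1 → 2 * (R * D).trace.re ≤ t * (D * D).trace.re := by
    intro t ht ht1
    have hmem : P + t • D ∈ C := hC.add_smul_sub_mem hP.1 hS ⟨ht.le, ht1⟩
    have hle := hP.2 _ hmem
    rw [← sub_sub, ← hRdef] at hle
    have hRD : (R - t • D)ᴴ = R - t • D := by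
      rw [conjTranspose_sub, conjTranspose_smul, hR.eq, hD.eq, star_trivial]
    unfold frob at hle
    rw [Real.sqrt_le_sqrt_iff (by positivity), ← re_trace_mul_conjTranspose,
      ← re_trace_mul_conjTranspose, hRD, hR.eq] at hle
    simp only [mul_sub, sub_mul, trace_sub, mul_smul_comm, smul_mul_assoc,
      trace_smul, trace_mul_comm D R, Complex.sub_re, Complex.smul_re, smul_eq_mul] at hle
    refine le_of_mul_le_mul_left ?_ ht
    linarith
  have hnonpos : (R * D).trace.re ≤ 0 := by
    by_contra! hpos
    have hDD : 0 ≤ (D * D).trace.re := by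
      have := hexp 1 one_pos le_rfl
      linarith
    have ht : 0 < min 1 ((R * D).trace.re / ((D * D).trace.re + 1)) :=
      lt_min one_pos (by positivity)
    have h1 := hexp _ ht (min_le_left _ _)
    have h2 : min 1 ((R * D).trace.re / ((D * D).trace.re + 1)) * (D * D).trace.re ≤
        (R * D).trace.re :=
      calc _ ≤ (R * D).trace.re / ((D * D).trace.re + 1) * ((D * D).trace.re + 1) := by
            gcongr
            · exact min_le_right _ _
            · linarith
        _ = _ := div_mul_cancel₀ _ (by positivity)
    linarith
  rw [hDdef, mul_sub, trace_sub, Complex.sub_re] at hnonpos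
  linarith

lemma re_trace_mul_eq_sum {A U : Mat m} {μ : Fin m → ℝ} (hU : U * Uᴴ = 1)
    (hA : Uᴴ * A * U = diagonal fun i => (μ i : ℂ)) (S : Mat m) :
    (A * S).trace.re = ∑ i, μ i * ((Uᴴ * S * U) i i).re := by
  have h : (A * S).trace = ((Uᴴ * A * U) * (Uᴴ * S * U)).trace := by
    have : (Uᴴ * A * U) * (Uᴴ * S * U) = Uᴴ * (A * (U * Uᴴ) * S) * U := by
      simp only [Matrix.mul_assoc]
    rw [this, hU, mul_one, trace_mul_cycle, hU, one_mul]
  rw [h, hA]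
  simp [trace, diagonal_mul]

/-- The operator norm of the residual is minimal. -/
lemma IsProjOn.opNorm_sub_le {Z P S : Mat m} (hZ : Z.IsHermitian)
    (hP : IsProjOn (Densities m) Z P) (hS : S ∈ Densities m) :
    opNorm (Z - P) ≤ opNorm (Z - S) := by
  have hR : (Z - P).IsHermitian := hZ.sub hP.1.1.isHermitian
  set U : Mat m := hR.eigenvectorUnitary.1
  have hUU : U * Uᴴ = 1 := Unitary.coe_mul_star_self _
  have hUU' : Uᴴ * U = 1 := Unitary.coe_star_mul_self _
  have hdiag : Uᴴ * (Z - P) * U = diagonal fun i => (hR.eigenvalues i : ℂ) := by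
    have := hR.conjStarAlgAut_star_eigenvectorUnitary
    rw [Unitary.conjStarAlgAut_star_apply] at this
    exact this
  have hP' := IsDensity.conj hP.1 hUU
  have hS' := IsDensity.conj hS hUU
  have hmax : ∀ i, hR.eigenvalues i ≤ ∑ j, hR.eigenvalues j * ((Uᴴ * P * U) j j).re := by
    intro i
    have hT : IsDensity (U * diagonal (Pi.single i 1) * Uᴴ) := by
      simpa using (isDensity_single i).conj (U := Uᴴ) (by simpa using hUU')
    have hTU : Uᴴ * (U * diagonal (Pi.single i 1) * Uᴴ) * U = diagonal (Pi.single i 1) := by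
      simp only [← Matrix.mul_assoc, hUU', one_mul]
      rw [Matrix.mul_assoc, hUU', mul_one]
    have := hP.re_trace_mul_le convex_densities hT hR (hT.1.isHermitian.sub hP.1.1.isHermitian)
    rw [re_trace_mul_eq_sum hUU hdiag, re_trace_mul_eq_sum hUU hdiag, hTU] at this
    simpa [Pi.single_apply, apply_ite Complex.re] using this
  have hN : ∀ i, |hR.eigenvalues i + ((Uᴴ * P * U) i i).re - ((Uᴴ * S * U) i i).re| ≤
      opNorm (Z - S) := by
    intro i
    have h := abs_re_conj_apply_le_opNorm (hZ.sub hS.1.isHermitian) hUU' i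
    have hsplit : Uᴴ * (Z - S) * U = Uᴴ * (Z - P) * U + Uᴴ * P * U - Uᴴ * S * U := by
      simp only [mul_sub, sub_mul]
      abel
    rw [hsplit, hdiag] at h
    simpa using h
  have : Nonempty (Fin m) := by
    by_contra hne
    rw [not_nonempty_iff] at hne
    simpa using hP'.sum_diag_re
  refine ciSup_le fun i => ?_
  simpa [eigs, hR] using abs_le_of_isMaxOn_support hP'.diag_re_nonneg hP'.sum_diag_re
    hS'.diag_re_nonneg hS'.sum_diag_re hmax hN i

/-- The Hilbert–Schmidt projection of a Hermitian matrix `Z` onto the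
set of density matrices is also a closest density matrix to `Z` in the operator norm. -/
theorem stmt0 {m : ℕ} (Z : Mat m) (hZ : Z.IsHermitian)
    (P : Mat m) (hP : IsProjOn (Densities m) Z P) :
    opNorm (Z - P) = sInf {x : ℝ | ∃ S ∈ Densities m, x = opNorm (Z - S)} := by
  have hleast : IsLeast {x : ℝ | ∃ S ∈ Densities m, x = opNorm (Z - S)} (opNorm (Z - P)) := by
    refine ⟨⟨P, hP.1, rfl⟩, ?_⟩
    rintro x ⟨S, hS, rfl⟩
    exact hP.opNorm_sub_le hZ hS
  exact hleast.csInf_eq.symm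

end QST
end
end

section
/- Let S, S' be m×m density matrices with rank(S) = r. Then for all p ∈ [1, ∞], ‖S' − S‖_p ≤ min( (8r)^{1/p} ‖S' − S‖_∞ , 2^{1/p} ‖S' − S‖_∞^{1−1/p} ). -/
open scoped BigOperators ENNReal
open MeasureTheory ProbabilityTheory Matrix
open scoped ComplexOrder

noncomputable section

namespace QST

variable {m : ℕ}

theorem eigs_eq {A : Mat m} (h : A.IsHermitian) : eigs A = h.eigenvalues := by
  simp [eigs, h]

theorem opNorm_nonneg (A : Mat m) : 0 ≤ opNorm A :=
  Real.iSup_nonneg fun _ => abs_nonneg _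

theorem abs_eigs_le_opNorm (A : Mat m) (i : Fin m) : |eigs A i| ≤ opNorm A :=
  le_ciSup (f := fun i => |eigs A i|) (Set.finite_range _).bddAbove i

/-- Interpolation between the trace norm and the operator norm. -/
theorem sum_abs_eigs_rpow_le {q : ℝ} (hq : 1 ≤ q) (A : Mat m) :
    ∑ i, |eigs A i| ^ q ≤ (∑ i, |eigs A i|) * opNorm A ^ (q - 1) := by
  rw [Finset.sum_mul]
  refine Finset.sum_le_sum fun i _ => ?_
  rcases (abs_nonneg (eigs A i)).eq_or_lt with h | h
  · rw [← h, Real.zero_rpow (by linarith), zero_mul]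
  · calc |eigs A i| ^ q = |eigs A i| * |eigs A i| ^ (q - 1) := by
          rw [← Real.rpow_one_add' h.le (by linarith)]; congr 1; ring
      _ ≤ _ := by
          have := abs_eigs_le_opNorm A i
          gcongr

/-- Conjugating `S` and `S'` by the eigenvector unitary of their difference diagonalizes the latter. -/
theorem exists_simultaneous_conj {S S' : Mat m} (hS : S.PosSemidef) (hS' : S'.PosSemidef) :
    ∃ P P' : Mat m, P.PosSemidef ∧ P'.PosSemidef ∧ P.trace = S.trace ∧ P'.trace = S'.trace ∧
      P.rank ≤ S.rank ∧ P' - P = diagonal fun i => (eigs (S' - S) i : ℂ) := by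
  have h : (S' - S).IsHermitian := hS'.isHermitian.sub hS.isHermitian
  let U : Mat m := ↑h.eigenvectorUnitary
  have hUU : U * Uᴴ = 1 := Unitary.mul_star_self_of_mem h.eigenvectorUnitary.2
  have hUU' : Uᴴ * U = 1 := Unitary.star_mul_self_of_mem h.eigenvectorUnitary.2
  have htr (T : Mat m) : (Uᴴ * T * U).trace = T.trace := by
    rw [trace_mul_comm, ← mul_assoc, hUU, one_mul]
  refine ⟨Uᴴ * S * U, Uᴴ * S' * U, hS.conjTranspose_mul_mul_same U,
    hS'.conjTranspose_mul_mul_same U, htr S, htr S',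
    (rank_mul_le_left _ _).trans (rank_mul_le_right _ _), ?_⟩
  have hspec : S' - S = U * diagonal (fun i => (h.eigenvalues i : ℂ)) * Uᴴ :=
    h.spectral_theorem
  rw [← sub_mul, ← mul_sub, eigs_eq h]
  calc Uᴴ * (S' - S) * U
      = (Uᴴ * U) * diagonal (fun i => (h.eigenvalues i : ℂ)) * (Uᴴ * U) := by
        refine (congrArg (Uᴴ * · * U) hspec).trans ?_
        simp only [mul_assoc]
    _ = _ := by rw [hUU', one_mul, mul_one]

theorem sum_abs_eigs_le_two {S S' : Mat m} (hS : IsDensity S) (hS' : IsDensity S') :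
    ∑ i, |eigs (S' - S) i| ≤ 2 := by
  obtain ⟨P, P', hP, hP', htr, htr', -, hd⟩ := exists_simultaneous_conj hS.1 hS'.1
  have hre {Q : Mat m} (hQ : Q.PosSemidef) (i : Fin m) : 0 ≤ (Q i i).re :=
    (Complex.le_def.1 hQ.diag_nonneg).1
  have hsum {Q : Mat m} (hQ : Q.trace = 1) : ∑ i, (Q i i).re = 1 := by
    simpa [trace] using congrArg Complex.re hQ
  have hi (i : Fin m) : |eigs (S' - S) i| ≤ (P' i i).re + (P i i).re := by
    have := congrArg Complex.re (congrFun (congrFun hd i) i)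
    simp only [Matrix.sub_apply, diagonal_apply_eq, Complex.sub_re, Complex.ofReal_re] at this
    rw [← this, abs_le]
    constructor <;> linarith [hre hP i, hre hP' i]
  calc _ ≤ ∑ i, ((P' i i).re + (P i i).re) := Finset.sum_le_sum fun i _ => hi i
    _ = 2 := by
      rw [Finset.sum_add_distrib, hsum (htr.trans hS.2), hsum (htr'.trans hS'.2)]; norm_num

/-- The difference `S' - S` has at most `rank S` negative eigenvalues. -/
theorem card_eigs_neg_le_rank {S S' : Mat m} (hS : S.PosSemidef) (hS' : S'.PosSemidef) :
    (Finset.univ.filter fun i => eigs (S' - S) i < 0).card ≤ S.rank := by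
  obtain ⟨P, P', hP, hP', -, -, hr, hd⟩ := exists_simultaneous_conj hS hS'
  let f : {i // eigs (S' - S) i < 0} → Fin m := Subtype.val
  have hdiag : (diagonal fun i : {i // eigs (S' - S) i < 0} =>
      ((-eigs (S' - S) i : ℝ) : ℂ)).PosDef :=
    PosDef.diagonal fun i => by
      have := i.2
      exact_mod_cast neg_pos.2 this
  have heq : P.submatrix f f = (diagonal fun i : {i // eigs (S' - S) i < 0} =>
      ((-eigs (S' - S) i : ℝ) : ℂ)) + P'.submatrix f f := by
    ext i j
    have := congrFun (congrFun hd i) j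
    simp only [Matrix.sub_apply, diagonal_apply, ← Subtype.ext_iff] at this
    simp only [Matrix.add_apply, diagonal_apply, submatrix_apply, f]
    split_ifs at this ⊢ with hij
    · push_cast; linear_combination -this
    · linear_combination -this
  have hpos : (P.submatrix f f).PosDef := heq ▸ hdiag.add_posSemidef (hP'.submatrix f)
  calc _ = Fintype.card {i // eigs (S' - S) i < 0} := (Fintype.card_subtype _).symm
    _ = (P.submatrix f f).rank := (rank_of_isUnit _ hpos.isUnit).symm
    _ ≤ P.rank := rank_submatrix_le P f f
    _ ≤ S.rank := hr

theorem sum_eigs_sub_eq_zero {S S' : Mat m} (hS : IsDensity S) (hS' : IsDensity S') :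
    ∑ i, eigs (S' - S) i = 0 := by
  have h : (S' - S).IsHermitian := hS'.1.isHermitian.sub hS.1.isHermitian
  have := h.trace_eq_sum_eigenvalues
  rw [trace_sub, hS.2, hS'.2, sub_self, ← eigs_eq h] at this
  rw [← Complex.ofReal_inj, Complex.ofReal_sum, Complex.ofReal_zero]
  exact this.symm

theorem sum_abs_eigs_le_rank {S S' : Mat m} (hS : IsDensity S) (hS' : IsDensity S') :
    ∑ i, |eigs (S' - S) i| ≤ 2 * S.rank * opNorm (S' - S) := by
  have hsum := sum_eigs_sub_eq_zero hS hS'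
  set M := opNorm (S' - S)
  have hi (i : Fin m) : |eigs (S' - S) i| ≤
      eigs (S' - S) i + if eigs (S' - S) i < 0 then 2 * M else 0 := by
    have hle := abs_eigs_le_opNorm (S' - S) i
    split_ifs with h
    · rw [abs_of_neg h] at hle ⊢
      linarith
    · rw [abs_of_nonneg (not_lt.1 h), add_zero]
  have hcard : ((Finset.univ.filter fun i => eigs (S' - S) i < 0).card : ℝ) ≤ S.rank := by
    exact_mod_cast card_eigs_neg_le_rank hS.1 hS'.1
  calc _ ≤ _ := Finset.sum_le_sum fun i _ => hi i
    _ = (Finset.univ.filter fun i => eigs (S' - S) i < 0).card * (2 * M) := by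
      rw [Finset.sum_add_distrib, hsum, zero_add, ← Finset.sum_filter, Finset.sum_const,
        nsmul_eq_mul]
    _ ≤ S.rank * (2 * M) := by
      have := opNorm_nonneg (S' - S)
      gcongr
    _ = _ := by ring

/-- If `S, S'` are density matrices and `rank S = r`, then for all
`p ∈ [1,∞]`, `‖S' - S‖_p ≤ min((8r)^{1/p} ‖S'-S‖_∞, 2^{1/p} ‖S'-S‖_∞^{1-1/p})`. -/
theorem stmt2 {m r : ℕ} (p : ℝ≥0∞) (hp : 1 ≤ p)
    (S S' : Mat m) (hS : IsDensity S) (hS' : IsDensity S') (hrank : S.rank = r) :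
    schatten p (S' - S) ≤
      min ((8 * (r : ℝ)) ^ (1 / p).toReal * opNorm (S' - S))
        ((2 : ℝ) ^ (1 / p).toReal * opNorm (S' - S) ^ (1 - (1 / p).toReal)) := by
  have hM := opNorm_nonneg (S' - S)
  by_cases hp_top : p = ∞
  · simp [schatten, hp_top]
  have hq : 1 ≤ p.toReal := by
    simpa using ENNReal.toReal_mono hp_top hp
  have hqi : (1 / p).toReal = 1 / p.toReal := by simp
  have hpow := sum_abs_eigs_rpow_le hq (S' - S)
  rw [schatten, if_neg hp_top, hqi]
  set q := p.toReal
  set M := opNorm (S' - S)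
  have hq0 : q ≠ 0 := by positivity
  have hnonneg : 0 ≤ ∑ i, |eigs (S' - S) i| ^ q := by positivity
  refine le_min ?_ ?_
  · have h1 : ∑ i, |eigs (S' - S) i| ^ q ≤ 8 * r * M ^ q := by
      have hrank' := sum_abs_eigs_le_rank hS hS'
      rw [hrank] at hrank'
      calc _ ≤ _ := hpow
        _ ≤ (8 * r * M) * M ^ (q - 1) := by
          gcongr
          refine hrank'.trans ?_
          gcongr
          norm_num
        _ = 8 * r * M ^ q := by
          rw [mul_assoc, ← Real.rpow_one_add' hM (by simpa using hq0)]
          congr 2; ring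
    calc _ ≤ (8 * r * M ^ q) ^ (1 / q) := by gcongr
      _ = _ := by
        rw [Real.mul_rpow (by positivity) (by positivity), ← Real.rpow_mul hM,
          mul_one_div_cancel hq0, Real.rpow_one]
  · have h2 : ∑ i, |eigs (S' - S) i| ^ q ≤ 2 * M ^ (q - 1) :=
      hpow.trans (by gcongr; exact sum_abs_eigs_le_two hS hS')
    calc _ ≤ (2 * M ^ (q - 1)) ^ (1 / q) := by gcongr
      _ = _ := by
        rw [Real.mul_rpow (by positivity) (by positivity), ← Real.rpow_mul hM]
        congr 2
        field_simp

end QST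
end
end

section
/- Let S₁, S₂ be m×m density matrices and let β := λ_min(S₂) be the smallest eigenvalue of S₂. If β > 0, then the quantum relative entropy satisfies K(S₁‖S₂) ≤ ‖S₁ − S₂‖₁ · log(1 + ‖S₁ − S₂‖₁/(2β)). -/
open scoped BigOperators ENNReal
open MeasureTheory ProbabilityTheory Matrix
open scoped ComplexOrder

noncomputable section

namespace QST

variable {m : ℕ}

section
open scoped MatrixOrder Matrix.Norms.L2Operator

lemma hermApply_eq_cfc (f : ℝ → ℝ) {A : Mat m} (hA : A.IsHermitian) :
    hermApply f A = cfc f A := by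
  rw [hA.cfc_eq, hermApply, dif_pos hA, IsHermitian.cfc, Unitary.conjStarAlgAut_apply]
  rfl

lemma continuousOn_spectrum (f : ℝ → ℝ) (A : Mat m) : ContinuousOn f (spectrum ℝ A) :=
  (Matrix.finite_real_spectrum (A := A)).continuousOn f

/-- The real part of the trace. -/
def reTrace (A : Mat m) : ℝ := (Matrix.trace A).re

lemma reTrace_add (A B : Mat m) : reTrace (A + B) = reTrace A + reTrace B := by
  simp [reTrace]

lemma reTrace_sub (A B : Mat m) : reTrace (A - B) = reTrace A - reTrace B := by
  simp [reTrace]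

lemma reTrace_smul (c : ℝ) (A : Mat m) : reTrace (c • A) = c * reTrace A := by
  simp [reTrace]

/-- Traces of products of functions of two Hermitian matrices, in terms of their eigenvalues. -/
lemma exists_weights_reTrace_cfc_mul_cfc {A B : Mat m} (hA : A.IsHermitian)
    (hB : B.IsHermitian) :
    ∃ w : Fin m → Fin m → ℝ, (∀ i j, 0 ≤ w i j) ∧ ∀ f g : ℝ → ℝ,
      reTrace (cfc f A * cfc g B) =
        ∑ i, ∑ j, w i j * (f (hA.eigenvalues i) * g (hB.eigenvalues j)) := by
  let W : Mat m := star (hA.eigenvectorUnitary : Mat m) * (hB.eigenvectorUnitary : Mat m)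
  refine ⟨fun i j => Complex.normSq (W i j), fun i j => Complex.normSq_nonneg _, fun f g => ?_⟩
  rw [← hermApply_eq_cfc f hA, ← hermApply_eq_cfc g hB, hermApply, hermApply, dif_pos hA,
    dif_pos hB]
  set D : Mat m := diagonal fun i => (f (hA.eigenvalues i) : ℂ)
  set E : Mat m := diagonal fun i => (g (hB.eigenvalues i) : ℂ)
  set U : Mat m := (hA.eigenvectorUnitary : Mat m)
  set V : Mat m := (hB.eigenvectorUnitary : Mat m)
  have h : trace (U * D * star U * (V * E * star V)) = trace (D * W * (E * star W)) := by
    have : star W = star V * U := by simp [W, U, V]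
    rw [this, trace_mul_comm (D * W), Matrix.mul_assoc U, Matrix.mul_assoc U, trace_mul_comm U]
    rw [trace_mul_comm (E * (star V * U))]
    simp only [W, U, V, Matrix.mul_assoc]
  rw [reTrace, h, trace]
  simp only [diag_apply, mul_apply (M := D * W), Complex.re_sum, D, E, diagonal_mul,
    star_apply]
  refine Finset.sum_congr rfl fun i _ => Finset.sum_congr rfl fun j _ => ?_
  simp only [Complex.normSq_apply, RCLike.star_def, Complex.mul_re, Complex.mul_im,
    Complex.ofReal_re, Complex.ofReal_im, Complex.conj_re, Complex.conj_im]
  ring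

lemma cfc_mul_cfc_id {A : Mat m} (hA : A.IsHermitian) (f : ℝ → ℝ) :
    A * cfc f A = cfc (fun x => x * f x) A := by
  rw [cfc_mul (fun x => x) f A (continuousOn_spectrum _ _) (continuousOn_spectrum _ _),
    cfc_id' ℝ A hA.isSelfAdjoint]

/-- **Klein's inequality** for `x ↦ x log x`. -/
lemma reTrace_mul_log_le {A B : Mat m} (hA : A.PosDef) (hB : B.PosDef) :
    reTrace (A * CFC.log B) ≤ reTrace (A * CFC.log A) + reTrace B - reTrace A := by
  obtain ⟨w, hw, h⟩ := exists_weights_reTrace_cfc_mul_cfc hA.1 hB.1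
  have h1 := h (fun x => x) Real.log
  have h2 := h (fun x => x * Real.log x) (fun _ => 1)
  have h3 := h (fun _ => 1) (fun x => x)
  have h4 := h (fun x => x) (fun _ => 1)
  rw [cfc_id' ℝ A hA.1.isSelfAdjoint] at h1 h4
  rw [cfc_id' ℝ B hB.1.isSelfAdjoint] at h3
  rw [← cfc_mul_cfc_id hA.1, cfc_const_one ℝ B hB.1.isSelfAdjoint, mul_one] at h2
  rw [cfc_const_one ℝ A hA.1.isSelfAdjoint, one_mul] at h3
  rw [cfc_const_one ℝ B hB.1.isSelfAdjoint, mul_one] at h4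
  rw [CFC.log, CFC.log, h1, h2, h3, h4, ← Finset.sum_add_distrib, ← Finset.sum_sub_distrib]
  refine Finset.sum_le_sum fun i _ => ?_
  rw [← Finset.sum_add_distrib, ← Finset.sum_sub_distrib]
  refine Finset.sum_le_sum fun j _ => ?_
  have ha := hA.eigenvalues_pos i
  have hb := hB.eigenvalues_pos j
  have hl := Real.log_le_sub_one_of_pos (div_pos hb ha)
  rw [Real.log_div hb.ne' ha.ne'] at hl
  have := mul_le_mul_of_nonneg_left hl ha.le
  have e : hA.1.eigenvalues i * (hB.1.eigenvalues j / hA.1.eigenvalues i - 1) =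
      hB.1.eigenvalues j - hA.1.eigenvalues i := by field_simp
  nlinarith [hw i j]

lemma reTrace_nonneg {A : Mat m} (hA : 0 ≤ A) : 0 ≤ reTrace A := by
  have := (nonneg_iff_posSemidef.1 hA).trace_nonneg
  exact (Complex.le_def.1 this).1

lemma reTrace_mul_nonneg {A B : Mat m} (hA : 0 ≤ A) (hB : 0 ≤ B) : 0 ≤ reTrace (A * B) := by
  rw [nonneg_iff_posSemidef] at hA hB
  obtain ⟨w, hw, h⟩ := exists_weights_reTrace_cfc_mul_cfc hA.1 hB.1
  have h1 := h (fun x => x) (fun x => x)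
  rw [cfc_id' ℝ A hA.1.isSelfAdjoint, cfc_id' ℝ B hB.1.isSelfAdjoint] at h1
  rw [h1]
  exact Finset.sum_nonneg fun i _ => Finset.sum_nonneg fun j _ =>
    mul_nonneg (hw i j) (mul_nonneg (hA.eigenvalues_nonneg i) (hB.eigenvalues_nonneg j))

lemma reTrace_mul_le_mul {A B C : Mat m} (hA : 0 ≤ A) (hBC : B ≤ C) :
    reTrace (A * B) ≤ reTrace (A * C) := by
  have := reTrace_mul_nonneg hA (sub_nonneg.2 hBC)
  rw [mul_sub, reTrace_sub] at this
  linarith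

lemma reTrace_mul_algebraMap (A : Mat m) (c : ℝ) :
    reTrace (A * algebraMap ℝ (Mat m) c) = c * reTrace A := by
  rw [Algebra.algebraMap_eq_smul_one, mul_smul_comm, mul_one, reTrace_smul]

lemma log_smul_posDef {A : Mat m} (hA : A.PosDef) {c : ℝ} (hc : 0 < c) :
    CFC.log (c • A) = algebraMap ℝ (Mat m) (Real.log c) + CFC.log A :=
  CFC.log_smul' A hc hA.isStrictlyPositive

lemma log_le_log_smul {A B : Mat m} (hA : A.PosDef) (hB : B.PosDef) {c : ℝ} (hc : 0 < c)
    (hAB : A ≤ c • B) : CFC.log A ≤ algebraMap ℝ (Mat m) (Real.log c) + CFC.log B := by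
  rw [← log_smul_posDef hB hc]
  exact CFC.log_le_log hAB hA.isStrictlyPositive

lemma log_smul_le_log {A B : Mat m} (hA : A.PosDef) {c : ℝ} (hc : 0 < c)
    (hAB : c • A ≤ B) : algebraMap ℝ (Mat m) (Real.log c) + CFC.log A ≤ CFC.log B := by
  rw [← log_smul_posDef hA hc]
  exact CFC.log_le_log hAB (hA.smul hc).isStrictlyPositive

/-- Comparison of increments along `[0, 1]`. -/
lemma sub_le_sub_of_increments {F G g : ℝ → ℝ}
    (hF : ∀ x y, 0 ≤ x → x ≤ y → y ≤ 1 → F y - F x ≤ (y - x) * g y)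
    (hG : ∀ x y, 0 ≤ x → x ≤ y → y ≤ 1 → (y - x) * g x ≤ G y - G x) :
    F 1 - F 0 ≤ G 1 - G 0 := by
  have key : ∀ n : ℕ, 0 < n → (F 1 - F 0) - (G 1 - G 0) ≤ (g 1 - g 0) * (1 / (n : ℝ)) := by
    intro n hn
    have hn' : (0 : ℝ) < n := by exact_mod_cast hn
    have step : ∀ k ∈ Finset.range n,
        ((F - G) (((k + 1 : ℕ) : ℝ) / n) - (F - G) ((k : ℝ) / n)) ≤
          (1 / (n : ℝ)) * (g (((k + 1 : ℕ) : ℝ) / n) - g ((k : ℝ) / n)) := by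
      intro k hk
      have hk' : ((k + 1 : ℕ) : ℝ) ≤ n := by exact_mod_cast Finset.mem_range.1 hk
      have h0 : (0 : ℝ) ≤ (k : ℝ) / n := by positivity
      have h1 : (k : ℝ) / n ≤ ((k + 1 : ℕ) : ℝ) / n := by gcongr; simp
      have h2 : ((k + 1 : ℕ) : ℝ) / n ≤ 1 := (div_le_one hn').2 hk'
      have e : ((k + 1 : ℕ) : ℝ) / n - (k : ℝ) / n = 1 / n := by push_cast; ring
      have a := hF _ _ h0 h1 h2
      have b := hG _ _ h0 h1 h2
      rw [e] at a b
      simp only [Pi.sub_apply]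
      linarith
    have := Finset.sum_le_sum step
    rw [← Finset.mul_sum, Finset.sum_range_sub (fun k : ℕ => (F - G) ((k : ℝ) / n)),
      Finset.sum_range_sub (fun k : ℕ => g ((k : ℝ) / n))] at this
    simp only [div_self hn'.ne', Nat.cast_zero, zero_div, Pi.sub_apply] at this
    linarith
  have lim : Filter.Tendsto (fun n : ℕ => (g 1 - g 0) * (1 / (n : ℝ))) Filter.atTop
      (nhds ((g 1 - g 0) * 0)) := tendsto_one_div_atTop_nhds_zero_nat.const_mul _
  have := ge_of_tendsto lim (Filter.eventually_atTop.2 ⟨1, fun n hn => key n hn⟩)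
  linarith

lemma posDef_of_smul_le {A B : Mat m} (hA : A.PosDef) {c : ℝ} (hc : 0 < c) (h : c • A ≤ B) :
    B.PosDef :=
  ((hA.smul hc).isStrictlyPositive.of_le h).posDef

/-- Bound on the Bregman divergence of `tr (x log x)` between `A + D` and `A`, by integrating
its derivative along the segment. -/
lemma bregman_le_of_increments {A D : Mat m} {G g : ℝ → ℝ}
    (hpos : ∀ t : ℝ, 0 ≤ t → t ≤ 1 → (A + t • D).PosDef)
    (hg : ∀ t, 0 ≤ t → t ≤ 1 → reTrace (D * (CFC.log (A + t • D) - CFC.log A)) ≤ g t)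
    (hG : ∀ x y, 0 ≤ x → x ≤ y → y ≤ 1 → (y - x) * g x ≤ G y - G x) :
    reTrace ((A + D) * (CFC.log (A + D) - CFC.log A)) - reTrace D ≤ G 1 - G 0 := by
  let F : ℝ → ℝ := fun t =>
    reTrace ((A + t • D) * (CFC.log (A + t • D) - CFC.log A)) - t * reTrace D
  have h := sub_le_sub_of_increments (F := F) (g := g) ?_ hG
  · simpa [F, reTrace] using h
  · intro x y hx hxy hy
    have k := reTrace_mul_log_le (hpos x hx (hxy.trans hy)) (hpos y (hx.trans hxy) hy)
    have l := mul_le_mul_of_nonneg_left (hg y (hx.trans hxy) hy) (sub_nonneg.2 hxy)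
    simp only [F]
    simp only [add_mul, mul_sub, reTrace_add, reTrace_sub, smul_mul_assoc, reTrace_smul] at k l ⊢
    linarith

lemma mul_log_increment {x y : ℝ} (hx : 0 < x) (hy : 0 < y) :
    (y - x) * Real.log x ≤ (y * Real.log y - y) - (x * Real.log x - x) := by
  have hl := Real.log_le_sub_one_of_pos (div_pos hx hy)
  rw [Real.log_div hx.ne' hy.ne'] at hl
  have := mul_le_mul_of_nonneg_left hl hy.le
  have e : y * (x / y - 1) = x - y := by field_simp
  linarith

/-- The divergence between `A + P` and `A` for a positive perturbation `P`. -/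
lemma bregman_add_le {A P : Mat m} {β s : ℝ} (hA : A.PosDef) (hP : 0 ≤ P) (hs : 0 ≤ s)
    (hPA : P ≤ s • A) (htr : reTrace P = β * s) :
    reTrace ((A + P) * (CFC.log (A + P) - CFC.log A)) ≤ β * ((1 + s) * Real.log (1 + s)) := by
  have hβs : 0 ≤ β * s := htr ▸ reTrace_nonneg hP
  have low : ∀ t : ℝ, 0 ≤ t → (1 : ℝ) • A ≤ A + t • P := fun t ht => by
    rw [one_smul]; exact le_add_of_nonneg_right (smul_nonneg ht hP)
  have up : ∀ t : ℝ, 0 ≤ t → A + t • P ≤ (1 + t * s) • A := fun t ht => by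
    rw [add_smul, one_smul, mul_smul]; gcongr
  have pos : ∀ t : ℝ, 0 ≤ t → (A + t • P).PosDef := fun t ht =>
    posDef_of_smul_le hA one_pos (low t ht)
  have h := bregman_le_of_increments (A := A) (D := P)
    (g := fun t => β * s * Real.log (1 + t * s))
    (G := fun t => β * ((1 + t * s) * Real.log (1 + t * s) - (1 + t * s)))
    (fun t ht _ => pos t ht) ?_ ?_
  · simp only [one_mul, zero_mul, add_zero, Real.log_one, mul_zero, zero_sub] at h
    linarith
  · intro t ht _
    have hc : 0 < 1 + t * s := by positivity
    have := log_le_log_smul (pos t ht) hA hc (up t ht)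
    have := reTrace_mul_le_mul hP (sub_le_iff_le_add.2 this)
    rw [reTrace_mul_algebraMap, htr] at this
    linarith
  · intro x y hx hxy _
    have := mul_log_increment (x := 1 + x * s) (y := 1 + y * s) (by positivity)
      (by have := hx.trans hxy; positivity)
    rcases hs.eq_or_lt with rfl | hs'
    · simp
    · have hβ : 0 ≤ β := nonneg_of_mul_nonneg_left hβs hs'
      have := mul_le_mul_of_nonneg_left this hβ
      linarith

/-- The divergence between `A + P - N` and `A` for a perturbation small relative to `A`. -/
lemma bregman_add_sub_le {A P N : Mat m} {β s : ℝ} (hA : A.PosDef) (hP : 0 ≤ P) (hN : 0 ≤ N)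
    (hβ : 0 ≤ β) (hs : 0 ≤ s) (hs1 : s < 1)
    (hPA : P ≤ s • A) (hNA : N ≤ s • A) (hPtr : reTrace P = β * s) (hNtr : reTrace N = β * s) :
    reTrace ((A + (P - N)) * (CFC.log (A + (P - N)) - CFC.log A)) ≤
      β * ((1 + s) * Real.log (1 + s) + (1 - s) * Real.log (1 - s)) := by
  have low : ∀ t : ℝ, 0 ≤ t → (1 - t * s) • A ≤ A + t • (P - N) := fun t ht => by
    have h1 := smul_le_smul_of_nonneg_left hNA ht
    have h2 := smul_nonneg ht hP
    rw [sub_smul, one_smul, mul_smul, smul_sub, sub_eq_add_neg]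
    gcongr
    rw [neg_le_sub_iff_le_add]
    exact h1.trans (le_add_of_nonneg_left h2)
  have up : ∀ t : ℝ, 0 ≤ t → A + t • (P - N) ≤ (1 + t * s) • A := fun t ht => by
    rw [add_smul, one_smul, mul_smul]
    gcongr
    exact (sub_le_self _ hN).trans hPA
  have hc' : ∀ t : ℝ, t ≤ 1 → 0 < 1 - t * s := fun t ht => by nlinarith
  have pos : ∀ t : ℝ, 0 ≤ t → t ≤ 1 → (A + t • (P - N)).PosDef := fun t ht ht1 =>
    posDef_of_smul_le hA (hc' t ht1) (low t ht)
  have h := bregman_le_of_increments (A := A) (D := P - N)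
    (g := fun t => β * s * (Real.log (1 + t * s) - Real.log (1 - t * s)))
    (G := fun t => β * (((1 + t * s) * Real.log (1 + t * s) - (1 + t * s)) +
      ((1 - t * s) * Real.log (1 - t * s) - (1 - t * s)))) pos ?_ ?_
  · simp only [one_mul, zero_mul, add_zero, Real.log_one, mul_zero, zero_sub, sub_zero,
      reTrace_sub P N, hPtr, hNtr] at h
    linarith
  · intro t ht ht1
    have hc : 0 < 1 + t * s := by positivity
    have u := log_le_log_smul (pos t ht ht1) hA hc (up t ht)
    have u := reTrace_mul_le_mul hP (sub_le_iff_le_add.2 u)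
    have l := log_smul_le_log hA (hc' t ht1) (low t ht)
    have l := reTrace_mul_le_mul hN (le_sub_iff_add_le.2 l)
    rw [reTrace_mul_algebraMap, hPtr] at u
    rw [reTrace_mul_algebraMap, hNtr] at l
    rw [sub_mul, reTrace_sub]
    linarith
  · intro x y hx hxy hy
    have hy0 := hx.trans hxy
    have a := mul_log_increment (x := 1 + x * s) (y := 1 + y * s) (by positivity)
      (by positivity)
    have b := mul_log_increment (hc' x (hxy.trans hy)) (hc' y hy)
    have a := mul_le_mul_of_nonneg_left a hβ
    have b := mul_le_mul_of_nonneg_left b hβ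
    linarith

/-- Monotonicity of the logarithm, tested against the smaller operator, which may be singular. -/
lemma reTrace_mul_log_mono {A B : Mat m} {b : ℝ} (hA : 0 ≤ A) (hAB : A ≤ B) (hb : 0 < b)
    (hB : b • (1 : Mat m) ≤ B) (hBpos : B.PosDef) :
    reTrace (A * CFC.log A) ≤ reTrace (A * CFC.log B) := by
  have hAh : A.IsHermitian := (nonneg_iff_posSemidef.1 hA).1
  have key : ∀ e : ℝ, 0 < e →
      reTrace (A * CFC.log A) ≤ Real.log (1 + e) * reTrace A + reTrace (A * CFC.log B) := by
    intro e he
    have hbe : 0 < e * b := mul_pos he hb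
    have hpd : (A + (e * b) • (1 : Mat m)).PosDef :=
      posDef_of_smul_le PosDef.one hbe (le_add_of_nonneg_left hA)
    have hle : A + (e * b) • (1 : Mat m) ≤ (1 + e) • B := by
      rw [add_smul, one_smul, mul_smul]
      gcongr
    have h1 := log_le_log_smul hpd hBpos (by positivity : 0 < 1 + e) hle
    have h1 := reTrace_mul_le_mul hA h1
    rw [mul_add, reTrace_add, reTrace_mul_algebraMap] at h1
    refine le_trans ?_ h1
    have e1 : A + (e * b) • (1 : Mat m) = cfc (fun x : ℝ => x + e * b) A := by
      rw [cfc_add_const (e * b) (fun x => x) A (continuousOn_spectrum _ _)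
        hAh.isSelfAdjoint, cfc_id' ℝ A hAh.isSelfAdjoint,
        Algebra.algebraMap_eq_smul_one]
    have e2 : CFC.log (A + (e * b) • (1 : Mat m)) = cfc (fun x => Real.log (x + e * b)) A := by
      rw [e1, CFC.log, ← cfc_comp' Real.log (fun x => x + e * b) A
        ((Matrix.finite_real_spectrum (A := A)).image _ |>.continuousOn _)
        (continuousOn_spectrum _ _) hAh.isSelfAdjoint]
    rw [e2, CFC.log, cfc_mul_cfc_id hAh, cfc_mul_cfc_id hAh, ← sub_nonneg, ← reTrace_sub]
    refine reTrace_nonneg (sub_nonneg.2 (cfc_mono (fun x hx => ?_)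
      (continuousOn_spectrum _ _) (continuousOn_spectrum _ _)))
    have hx0 : 0 ≤ x := spectrum_nonneg_of_nonneg hA hx
    rcases hx0.eq_or_lt with rfl | hx0
    · simp
    · exact mul_le_mul_of_nonneg_left (Real.log_le_log hx0 (by linarith)) hx0.le
  have lim : Filter.Tendsto
      (fun e : ℝ => Real.log (1 + e) * reTrace A + reTrace (A * CFC.log B))
      (nhdsWithin 0 (Set.Ioi 0))
      (nhds (Real.log (1 + 0) * reTrace A + reTrace (A * CFC.log B))) := by
    refine Filter.Tendsto.mono_left ?_ nhdsWithin_le_nhds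
    refine ContinuousAt.tendsto (f := fun e : ℝ =>
      Real.log (1 + e) * reTrace A + reTrace (A * CFC.log B)) ?_
    fun_prop (disch := norm_num)
  have := ge_of_tendsto lim (Filter.eventually_of_mem self_mem_nhdsWithin fun e he => key e he)
  simpa using this

lemma cfc_le_smul_one {A : Mat m} (hA : A.IsHermitian) (f : ℝ → ℝ) {c : ℝ}
    (h : ∀ i, f (hA.eigenvalues i) ≤ c) : cfc f A ≤ c • (1 : Mat m) := by
  rw [← Algebra.algebraMap_eq_smul_one]
  refine cfc_le_algebraMap f c A (fun x hx => ?_) (continuousOn_spectrum _ _) hA.isSelfAdjoint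
  rw [hA.spectrum_real_eq_range_eigenvalues] at hx
  obtain ⟨i, rfl⟩ := hx
  exact h i

lemma reTrace_cfc {A : Mat m} (hA : A.IsHermitian) (f : ℝ → ℝ) :
    reTrace (cfc f A) = ∑ i, f (hA.eigenvalues i) := by
  rw [← hermApply_eq_cfc f hA, hermApply, dif_pos hA, reTrace, trace_mul_comm,
    ← Matrix.mul_assoc, Unitary.coe_star_mul_self, one_mul, trace_diagonal, Complex.re_sum]
  simp

/-- Jordan decomposition of a traceless Hermitian matrix. -/
lemma exists_jordan_decomposition {D : Mat m} (hD : D.IsHermitian) (htr : reTrace D = 0) :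
    ∃ P N : Mat m, 0 ≤ P ∧ 0 ≤ N ∧ D = P - N ∧
      reTrace P = schatten 1 D / 2 ∧ reTrace N = schatten 1 D / 2 ∧
      P ≤ (schatten 1 D / 2) • (1 : Mat m) ∧ N ≤ (schatten 1 D / 2) • (1 : Mat m) := by
  have hS : schatten 1 D = ∑ i, |hD.eigenvalues i| := by
    simp [schatten, eigs, hD]
  have hsum : ∑ i, hD.eigenvalues i = 0 := by
    rw [← htr]
    conv_rhs => rw [← cfc_id' ℝ D hD.isSelfAdjoint]
    rw [reTrace_cfc hD]
  have hP : ∑ i, max (hD.eigenvalues i) 0 = schatten 1 D / 2 := by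
    have : ∀ x : ℝ, max x 0 = (|x| + x) / 2 := fun x => by
      rcases le_total x 0 with h | h
      · rw [max_eq_right h, abs_of_nonpos h]; ring
      · rw [max_eq_left h, abs_of_nonneg h]; ring
    simp_rw [this]
    rw [← Finset.sum_div, Finset.sum_add_distrib, hsum, hS, add_zero]
  have hN : ∑ i, max (-hD.eigenvalues i) 0 = schatten 1 D / 2 := by
    have : ∀ x : ℝ, max (-x) 0 = max x 0 - x := fun x => by
      rcases le_total x 0 with h | h
      · rw [max_eq_right h, max_eq_left (by linarith)]; ring
      · rw [max_eq_left h, max_eq_right (by linarith)]; ring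
    simp_rw [this]
    rw [Finset.sum_sub_distrib, hP, hsum, sub_zero]
  refine ⟨cfc (fun x => max x 0) D, cfc (fun x => max (-x) 0) D,
    cfc_nonneg fun x _ => le_max_right _ _, cfc_nonneg fun x _ => le_max_right _ _, ?_,
    (reTrace_cfc hD _).trans hP, (reTrace_cfc hD _).trans hN,
    cfc_le_smul_one hD _ fun i => hP ▸ ?_, cfc_le_smul_one hD _ fun i => hN ▸ ?_⟩
  · rw [← cfc_sub _ _ D (continuousOn_spectrum _ _) (continuousOn_spectrum _ _)]
    conv_lhs => rw [← cfc_id' ℝ D hD.isSelfAdjoint]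
    congr 1
    funext x
    rcases le_total x 0 with h | h
    · rw [max_eq_right h, max_eq_left (by linarith)]; ring
    · rw [max_eq_left h, max_eq_right (by linarith)]; ring
  · exact Finset.single_le_sum (f := fun i => max (hD.eigenvalues i) 0)
      (fun j _ => le_max_right _ _) (Finset.mem_univ i)
  · exact Finset.single_le_sum (f := fun i => max (-hD.eigenvalues i) 0)
      (fun j _ => le_max_right _ _) (Finset.mem_univ i)

lemma smul_one_le_of_le_eigs {A : Mat m} (hA : A.IsHermitian) :
    (⨅ i, eigs A i) • (1 : Mat m) ≤ A := by
  rw [← Algebra.algebraMap_eq_smul_one]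
  refine (algebraMap_le_iff_le_spectrum (a := A) hA.isSelfAdjoint).2 fun x hx => ?_
  rw [hA.spectrum_real_eq_range_eigenvalues] at hx
  obtain ⟨i, rfl⟩ := hx
  have : eigs A = hA.eigenvalues := dif_pos hA
  rw [this]
  exact ciInf_le (Set.finite_range _).bddBelow i

lemma relEntropy_le_schatten_mul_log (S₁ S₂ : Mat m) (h₁ : IsDensity S₁) (h₂ : IsDensity S₂)
    (β : ℝ) (hβ : β = ⨅ i, eigs S₂ i) (hβpos : 0 < β) :
    relEntropy S₁ S₂ ≤
      schatten 1 (S₁ - S₂) * Real.log (1 + schatten 1 (S₁ - S₂) / (2 * β)) := by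
  have hh₁ : S₁.IsHermitian := h₁.1.1
  have hh₂ : S₂.IsHermitian := h₂.1.1
  have hlow : β • (1 : Mat m) ≤ S₂ := hβ ▸ smul_one_le_of_le_eigs hh₂
  have hpd : S₂.PosDef := posDef_of_smul_le PosDef.one hβpos hlow
  have hS₁ : 0 ≤ S₁ := nonneg_iff_posSemidef.2 h₁.1
  obtain ⟨P, N, hP, hN, hD, hPtr, hNtr, hP1, hN1⟩ :=
    exists_jordan_decomposition (hh₁.sub hh₂) (by simp [reTrace, h₁.2, h₂.2])
  set T := schatten 1 (S₁ - S₂)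
  obtain ⟨s, hs⟩ : ∃ s, s = T / (2 * β) := ⟨_, rfl⟩
  have hT : T = 2 * (β * s) := by rw [hs]; field_simp
  have hT2 : T / 2 = β * s := by rw [hT]; ring
  have hT0 : 0 ≤ T / 2 := hPtr ▸ reTrace_nonneg hP
  have hs0 : 0 ≤ s := nonneg_of_mul_nonneg_right (hT2 ▸ hT0) hβpos
  have hle : (T / 2) • (1 : Mat m) ≤ s • S₂ := by
    rw [hT2, mul_comm, mul_smul]
    exact smul_le_smul_of_nonneg_left hlow hs0
  rw [hT2] at hPtr hNtr
  have hPA := hP1.trans hle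
  have hNA := hN1.trans hle
  have hS : S₁ = S₂ + (P - N) := by rw [← hD]; abel
  have hK : relEntropy S₁ S₂ = reTrace (S₁ * (CFC.log S₁ - CFC.log S₂)) := by
    rw [relEntropy, hermApply_eq_cfc _ hh₁, hermApply_eq_cfc _ hh₂, mul_sub]
    rfl
  rw [hK, ← hs, hT]
  have hlog : 0 ≤ Real.log (1 + s) := Real.log_nonneg (by linarith)
  rcases lt_or_ge s 1 with hs1 | hs1
  · have h := bregman_add_sub_le hpd hP hN hβpos.le hs0 hs1 hPA hNA hPtr hNtr
    rw [← hS] at h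
    have hsum : Real.log (1 + s) + Real.log (1 - s) ≤ 0 := by
      rw [← Real.log_mul (by linarith) (by linarith)]
      exact Real.log_nonpos (by nlinarith) (by nlinarith)
    have := mul_nonneg hβpos.le (mul_nonneg (sub_nonneg.2 hs1.le) (neg_nonneg.2 hsum))
    linarith
  · have hC : S₁ + N = S₂ + P := by rw [hS]; abel
    have hSC : S₂ ≤ S₂ + P := le_add_of_nonneg_right hP
    have hCpd : (S₂ + P).PosDef := posDef_of_smul_le PosDef.one hβpos (hlow.trans hSC)
    have a := reTrace_mul_log_mono hS₁ (hC ▸ le_add_of_nonneg_right hN) hβpos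
      (hlow.trans hSC) hCpd
    have b := bregman_add_le hpd hP hs0 hPA hPtr
    have c := reTrace_mul_le_mul hN
      (sub_nonneg.2 (CFC.log_le_log hSC hpd.isStrictlyPositive))
    rw [mul_zero] at c
    have c0 : reTrace (0 : Mat m) = 0 := by simp [reTrace]
    rw [← hC, add_mul, reTrace_add, hC] at b
    have d := mul_nonneg (mul_nonneg hβpos.le (sub_nonneg.2 hs1)) hlog
    simp only [mul_sub, reTrace_sub] at b c ⊢
    linarith

end

/-- If `β > 0` is the smallest eigenvalue of the density matrix `S₂`,
then `K(S₁‖S₂) ≤ ‖S₁ - S₂‖₁ log(1 + ‖S₁ - S₂‖₁/(2β))`. -/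
theorem stmt5 {m : ℕ} (S₁ S₂ : Mat m) (h₁ : IsDensity S₁) (h₂ : IsDensity S₂)
    (β : ℝ) (hβ : β = ⨅ i, eigs S₂ i) (hβpos : 0 < β) :
    relEntropy S₁ S₂ ≤
      schatten 1 (S₁ - S₂) * Real.log (1 + schatten 1 (S₁ - S₂) / (2 * β)) :=
  relEntropy_le_schatten_mul_log S₁ S₂ h₁ h₂ β hβ hβpos

end QST
end
end

section
/- Let Δ_m = {u ∈ ℝ^m : u_j ≥ 0 for all j, Σ_j u_j = 1} be the probability simplex and for z ∈ ℝ^m let π_{Δ_m}(z) be the Euclidean projection of z onto Δ_m. Then for every z ∈ ℝ^m, ‖z − π_{Δ_m}(z)‖_{ℓ∞} = min_{v ∈ Δ_m} ‖z − v‖_{ℓ∞}; that is, the Euclidean projection onto the simplex is also a closest point of the simplex in the supremum norm. -/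
open scoped BigOperators ENNReal
open MeasureTheory ProbabilityTheory Matrix
open scoped ComplexOrder

noncomputable section

namespace QST

variable {m : ℕ}

/-- First-order optimality: the residual of the projection is maximal on the support. -/
theorem IsProjSimplex.residual_le {z v : Fin m → ℝ} (hv : IsProjSimplex z v) {i : Fin m}
    (hi : 0 < v i) (j : Fin m) : z j - v j ≤ z i - v i := by
  obtain ⟨⟨hv0, hv1⟩, hmin⟩ := hv
  by_contra! hlt
  have hij : i ≠ j := by
    rintro rfl
    exact lt_irrefl _ hlt
  obtain ⟨t, ht0, hti, htd⟩ : ∃ t, 0 < t ∧ t ≤ v i ∧ t < (z j - v j) - (z i - v i) := by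
    refine ⟨min (v i) (((z j - v j) - (z i - v i)) / 2), ?_, min_le_left _ _, ?_⟩
    · exact lt_min hi (by linarith)
    · exact (min_le_right _ _).trans_lt (by linarith)
  set w : Fin m → ℝ := fun k => (if k = j then 1 else 0) - (if k = i then 1 else 0) with hw
  have hmem : (fun k => v k + t * w k) ∈ simplex m := by
    refine ⟨fun k => ?_, ?_⟩
    · have := hv0 k
      by_cases hki : k = i
      · subst hki
        simp only [hw, if_neg hij, if_true]
        linarith
      · simp only [hw, if_neg hki]
        split_ifs <;> linarith
    · simp only [Finset.sum_add_distrib, ← Finset.mul_sum, hv1, hw, Finset.sum_sub_distrib]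
      simp
  have h := hmin _ hmem
  unfold e2 at h
  rw [Real.sqrt_le_sqrt_iff (Finset.sum_nonneg fun _ _ => sq_nonneg _)] at h
  have hexp : ∑ k, (z - fun k => v k + t * w k) k ^ 2 =
      ∑ k, (z - v) k ^ 2 - 2 * t * ((z j - v j) - (z i - v i)) + 2 * t ^ 2 := by
    have hterm : ∀ k, (z - fun k => v k + t * w k) k ^ 2 =
        (z - v) k ^ 2 + (if k = j then t ^ 2 - 2 * t * (z k - v k) else 0) +
          (if k = i then t ^ 2 + 2 * t * (z k - v k) else 0) := by
      intro k
      simp only [hw, Pi.sub_apply]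
      by_cases hki : k = i
      · subst hki
        simp only [if_neg hij, if_true]
        ring
      · simp only [if_neg hki]
        split_ifs <;> ring
    simp only [hterm, Finset.sum_add_distrib, Finset.sum_ite_eq', Finset.mem_univ, if_true]
    ring
  rw [hexp] at h
  nlinarith [mul_pos ht0 (sub_pos.2 htd)]

theorem abs_le_linf (x : Fin m → ℝ) (j : Fin m) : |x j| ≤ linf x :=
  le_ciSup (f := fun j => |x j|) (Set.finite_range _).bddAbove j

/-- The Euclidean projection of `z` onto the probability simplex is also
a closest point of the simplex to `z` in the supremum norm. -/
theorem stmt6 {m : ℕ} (z v : Fin m → ℝ) (hv : IsProjSimplex z v) :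
    IsLeast {x : ℝ | ∃ u ∈ simplex m, x = linf (z - u)} (linf (z - v)) := by
  obtain ⟨hv0, hv1⟩ := hv.1
  refine ⟨⟨v, hv.1, rfl⟩, ?_⟩
  rintro x ⟨u, ⟨hu0, hu1⟩, rfl⟩
  have : Nonempty (Fin m) := by
    by_contra hne
    rw [not_nonempty_iff] at hne
    simp at hv1
  have hbound : ∀ j, |z j - u j| ≤ linf (z - u) := abs_le_linf (z - u)
  refine ciSup_le fun k => ?_
  rw [Pi.sub_apply, abs_le']
  constructor
  · obtain ⟨i, hi, hui⟩ : ∃ i, 0 < v i ∧ u i ≤ v i := by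
      by_contra! hcon
      have hle : ∀ i ∈ Finset.univ, v i ≤ u i := fun i _ =>
        (hv0 i).eq_or_lt.elim (fun h => h ▸ hu0 i) fun h => (hcon i h).le
      have heq := (Finset.sum_eq_sum_iff_of_le hle).1 (hv1.trans hu1.symm)
      obtain ⟨i, _, hi⟩ := Finset.exists_lt_of_sum_lt
        (f := fun _ : Fin m => (0 : ℝ)) (g := v) (s := Finset.univ) (by simp [hv1])
      exact (hcon i hi).ne (heq i (Finset.mem_univ i))
    have := hv.residual_le hi k
    have := le_abs_self (z i - u i)
    have := hbound i
    linarith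
  · rcases (hv0 k).eq_or_lt with hk | hk
    · have := hu0 k
      have := neg_le_abs (z k - u k)
      have := hbound k
      linarith
    · obtain ⟨j, _, hj⟩ := Finset.exists_le_of_sum_le (s := Finset.univ) Finset.univ_nonempty
        (hv1.trans hu1.symm).le
      have := hv.residual_le hk j
      have := neg_le_abs (z j - u j)
      have := hbound j
      linarith

end QST
end
end

section
/- Let z = (z₁,…,z_m) ∈ ℝ^m with z₁ ≥ z₂ ≥ … ≥ z_m. For j = 1,…,m set z̄_j := (z₁+…+z_j)/j, and let k := max{ j ≤ m : z̄_j ≤ z_j + 1/j } (this set contains j = 1, so k is well defined). Define λ = (λ₁,…,λ_m) by λ_j = z_j − z̄_k + 1/k for j ≤ k and λ_j = 0 for j > k. Then λ belongs to the simplex Δ_m and λ = π_{Δ_m}(z), the Euclidean projection of z onto Δ_m. -/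
open scoped BigOperators ENNReal
open MeasureTheory ProbabilityTheory Matrix
open scoped ComplexOrder

noncomputable section

namespace QST

variable {m : ℕ}

/-- First-order sufficient condition: `v` in the simplex is the projection of `z` as soon as
`z - v = t` on the support of `v` and `z ≤ t` off it. -/
theorem isProjSimplex_of_threshold {m : ℕ} {z v : Fin m → ℝ} (t : ℝ) (hv : v ∈ simplex m)
    (h : ∀ j, z j - v j = t ∨ (v j = 0 ∧ z j ≤ t)) : IsProjSimplex z v := by
  refine ⟨hv, fun u hu => Real.sqrt_le_sqrt ?_⟩
  have hpt : ∀ j, (z - v) j ^ 2 + 2 * t * (v j - u j) ≤ (z - u) j ^ 2 := by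
    intro j
    simp only [Pi.sub_apply]
    rcases h j with hj | ⟨hj, hzt⟩
    · rw [← hj]
      nlinarith [sq_nonneg (u j - v j)]
    · rw [hj]
      nlinarith [sq_nonneg (u j), mul_nonneg (hu.1 j) (sub_nonneg.2 hzt)]
  have hsum := Finset.sum_le_sum fun j (_ : j ∈ Finset.univ) => hpt j
  rw [Finset.sum_add_distrib, ← Finset.mul_sum, Finset.sum_sub_distrib, hv.2, hu.2] at hsum
  linarith

/-- Splitting off the last term of a partial sum over `Fin m`. -/
theorem sum_filter_le_succ {m : ℕ} (z : Fin m → ℝ) {k l : Fin m} (hkl : (l : ℕ) = k + 1) :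
    ∑ i ∈ Finset.univ.filter (fun i => i ≤ l), z i =
      z l + ∑ i ∈ Finset.univ.filter (fun i => i ≤ k), z i := by
  have hl : l ∉ Finset.univ.filter (fun i => i ≤ k) := by
    simp only [Finset.mem_filter, Finset.mem_univ, true_and, Fin.le_def]
    omega
  rw [← Finset.sum_insert hl]
  congr 1
  ext i
  simp only [Finset.mem_filter, Finset.mem_univ, true_and, Finset.mem_insert, Fin.le_def,
    Fin.ext_iff]
  omega

/-- Explicit formula for the Euclidean projection onto the simplex:
for `z` with nonincreasing coordinates, with `z̄_j` the partial averages,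
`k` the largest index with `z̄_k ≤ z_k + 1/k`, and
`λ_j = z_j - z̄_k + 1/k` for `j ≤ k`, `λ_j = 0` for `j > k`, the vector `λ` belongs to
the simplex and is the Euclidean projection of `z` onto it.
(Indices `0,…,m-1` of `Fin m` correspond to the indices `1,…,m` of the paper.) -/
theorem stmt7 {m : ℕ} (hm : 1 ≤ m) (z : Fin m → ℝ)
    (hz : ∀ i j : Fin m, i ≤ j → z j ≤ z i)
    (zbar : Fin m → ℝ)
    (hzbar : ∀ j : Fin m,
      zbar j = (∑ i ∈ Finset.univ.filter (fun i => i ≤ j), z i) / (((j : ℕ) : ℝ) + 1))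
    (k : Fin m)
    (hk1 : zbar k ≤ z k + 1 / (((k : ℕ) : ℝ) + 1))
    (hk2 : ∀ j : Fin m, k < j → ¬ zbar j ≤ z j + 1 / (((j : ℕ) : ℝ) + 1))
    (lam : Fin m → ℝ)
    (hlam : ∀ j : Fin m,
      lam j = if j ≤ k then z j - zbar k + 1 / (((k : ℕ) : ℝ) + 1) else 0) :
    IsProjSimplex z lam := by
  have hk0 : (0 : ℝ) < (k : ℕ) + 1 := by positivity
  have hcard : (Finset.univ.filter fun i : Fin m => i ≤ k).card = (k : ℕ) + 1 := by
    rw [← Fin.card_Iic]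
    congr 1
    ext i
    simp only [Finset.mem_filter, Finset.mem_univ, true_and, Finset.mem_Iic]
  have hS := hzbar k
  rw [eq_div_iff hk0.ne'] at hS
  refine isProjSimplex_of_threshold (zbar k - 1 / (((k : ℕ) : ℝ) + 1)) ⟨fun j => ?_, ?_⟩
    fun j => ?_
  · rw [hlam]
    split_ifs with hj
    · linarith [hz j k hj]
    · rfl
  · simp_rw [hlam]
    rw [← Finset.sum_filter, Finset.sum_add_distrib, Finset.sum_sub_distrib, ← hS]
    simp only [Finset.sum_const, hcard, nsmul_eq_mul]
    push_cast
    field_simp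
    ring
  · rw [hlam]
    split_ifs with hj
    · left
      ring
    · refine Or.inr ⟨rfl, ?_⟩
      have hkj : (k : ℕ) < j := not_le.1 hj
      let l : Fin m := ⟨k + 1, by omega⟩
      have hlv : (l : ℕ) = k + 1 := rfl
      have hlj : z j ≤ z l := hz l j (Fin.le_def.2 (by omega))
      have hl := not_le.1 (hk2 l (Fin.lt_def.2 (by omega)))
      rw [hzbar l, sum_filter_le_succ z hlv, ← hS, hlv, Nat.cast_succ,
        lt_div_iff₀ (by positivity), add_mul,
        one_div_mul_cancel (by positivity)] at hl
      have hzl : z l ≤ zbar k - 1 / (((k : ℕ) : ℝ) + 1) := by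
        rw [le_sub_iff_add_le, ← le_sub_iff_add_le', div_le_iff₀ hk0]
        linarith
      exact hlj.trans hzl

end QST
end
end

section
/- If D is an m×m Hermitian diagonal matrix, then its Hilbert–Schmidt projection π_{S_m}(D) onto the set of density matrices is a diagonal density matrix. -/
open scoped BigOperators ENNReal
open MeasureTheory ProbabilityTheory Matrix
open scoped ComplexOrder

noncomputable section

namespace QST

variable {m : ℕ}

/-- The diagonal part of a density matrix is a density matrix. -/
lemma IsDensity.diagonal_diag {A : Mat m} (hA : IsDensity A) : IsDensity (diagonal A.diag) :=
  ⟨PosSemidef.diagonal fun _ => hA.1.diag_nonneg, by rw [trace_diagonal]; exact hA.2⟩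

/-- A diagonal matrix is strictly closer to the diagonal part of a matrix with a nonzero
off-diagonal entry than to the matrix itself. -/
lemma frob_sub_diagonal_diag_lt {D P : Mat m} (hD : ∀ i j, i ≠ j → D i j = 0)
    {i j : Fin m} (hij : i ≠ j) (hP : P i j ≠ 0) :
    frob (D - diagonal P.diag) < frob (D - P) := by
  have hle (a b : Fin m) : ‖(D - diagonal P.diag) a b‖ ^ 2 ≤ ‖(D - P) a b‖ ^ 2 := by
    rcases eq_or_ne a b with rfl | hab
    · simp
    · simp [hD a b hab, diagonal_apply_ne _ hab]
  refine Real.sqrt_lt_sqrt (by positivity) ?_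
  refine Finset.sum_lt_sum (fun a _ => Finset.sum_le_sum fun b _ => hle a b)
    ⟨i, Finset.mem_univ i, Finset.sum_lt_sum (fun b _ => hle i b) ⟨j, Finset.mem_univ j, ?_⟩⟩
  have := pow_pos (norm_pos_iff.2 hP) 2
  simpa [hD i j hij, diagonal_apply_ne _ hij] using this

/-- The Hilbert–Schmidt projection of a Hermitian diagonal matrix onto
the density matrices is a diagonal density matrix. -/
theorem stmt10 {m : ℕ} (D : Mat m) (hD : D.IsHermitian)
    (hdiag : ∀ i j : Fin m, i ≠ j → D i j = 0)
    (P : Mat m) (hP : IsProjOn (Densities m) D P) :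
    IsDensity P ∧ ∀ i j : Fin m, i ≠ j → P i j = 0 := by
  refine ⟨hP.1, fun i j hij => ?_⟩
  by_contra hne
  exact (frob_sub_diagonal_diag_lt hdiag hij hne).not_ge (hP.2 _ (IsDensity.diagonal_diag hP.1))

end QST
end
end

section
/- Let E = {E₁,…,E_{m²}} be an orthonormal basis of H_m, let X₁,…,X_n ∈ E and Y₁,…,Y_n ∈ ℝ be arbitrary, and set Ẑ := (m²/n) Σ_{j=1}^n Y_j X_j, ρ̌ := π_{S_m}(Ẑ). Let ρ̂ be any minimizer over S ∈ S_m of Σ_{j=1}^n (Y_j − ⟨S, X_j⟩)². Then ‖ρ̌ − ρ̂‖₂ ≤ m² ‖ (1/n) Σ_{j=1}^n X_j ⊗ X_j − (1/m²) Σ_{k=1}^{m²} E_k ⊗ E_k ‖_op, where for A, B ∈ H_m the operator A ⊗ B acts on m×m matrices by C ↦ A·⟨C, B⟩ and ‖·‖_op is the operator norm of linear maps on the space of m×m matrices with the Hilbert–Schmidt norm. -/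
open scoped BigOperators ENNReal
open MeasureTheory ProbabilityTheory Matrix
open scoped ComplexOrder

noncomputable section

namespace QST

variable {m : ℕ}

/-- A matrix as a vector of the Euclidean space of its entries. -/
def vecEquiv (m : ℕ) : Mat m ≃ₗ[ℂ] EuclideanSpace ℂ (Fin m × Fin m) :=
  (LinearEquiv.curry ℂ ℂ (Fin m) (Fin m)).symm.trans
    (WithLp.linearEquiv 2 ℂ (Fin m × Fin m → ℂ)).symm

lemma vecEquiv_apply (A : Mat m) (p : Fin m × Fin m) : vecEquiv m A p = A p.1 p.2 := rfl

lemma norm_vecEquiv (A : Mat m) : ‖vecEquiv m A‖ = frob A := by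
  simp [EuclideanSpace.norm_eq, frob, vecEquiv_apply, Fintype.sum_prod_type]

lemma inner_vecEquiv (A B : Mat m) :
    inner ℂ (vecEquiv m B) (vecEquiv m A) = trace (A * Bᴴ) := by
  simp [PiLp.inner_apply, vecEquiv_apply, Fintype.sum_prod_type, trace, mul_apply]

lemma hsInner_comm (A B : Mat m) : hsInner A B = hsInner B A := by
  simp only [hsInner, ← inner_vecEquiv]
  exact inner_re_symm (𝕜 := ℂ) _ _

lemma hsInner_add_left (A B C : Mat m) : hsInner (A + B) C = hsInner A C + hsInner B C := by
  simp [hsInner, add_mul]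

lemma hsInner_sub_left (A B C : Mat m) : hsInner (A - B) C = hsInner A C - hsInner B C := by
  simp [hsInner, sub_mul]

lemma hsInner_smul_left (t : ℝ) (A B : Mat m) : hsInner (t • A) B = t * hsInner A B := by
  simp [hsInner]

lemma hsInner_sum_left {ι : Type*} (s : Finset ι) (f : ι → Mat m) (B : Mat m) :
    hsInner (∑ i ∈ s, f i) B = ∑ i ∈ s, hsInner (f i) B := by
  simp [hsInner, Finset.sum_mul, trace_sum]

lemma frob_sq (A : Mat m) : frob A ^ 2 = hsInner A A := by
  rw [← norm_vecEquiv, hsInner, ← inner_vecEquiv]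
  exact (inner_self_eq_norm_sq (𝕜 := ℂ) _).symm

lemma hsInner_le_frob_mul_frob (A B : Mat m) : hsInner A B ≤ frob A * frob B := by
  rw [hsInner_comm, hsInner, ← inner_vecEquiv, ← norm_vecEquiv, ← norm_vecEquiv]
  exact re_inner_le_norm (𝕜 := ℂ) _ _

lemma trace_mul_conjTranspose_eq_hsInner {A B : Mat m} (hA : A.IsHermitian)
    (hB : B.IsHermitian) : trace (A * Bᴴ) = (hsInner A B : ℂ) := by
  refine (Complex.conj_eq_iff_re.mp ?_).symm
  rw [starRingEnd_apply, ← trace_conjTranspose, conjTranspose_mul, conjTranspose_conjTranspose,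
    hA.eq, hB.eq, trace_mul_comm]

/-- Expansion of a matrix in an orthonormal basis of the Hermitian matrices. -/
lemma IsONBasis.sum_trace_smul {E : Fin (m ^ 2) → Mat m} (hE : IsONBasis E) (A : Mat m) :
    ∑ k, trace (A * (E k)ᴴ) • E k = A := by
  have hon : Orthonormal ℂ fun k => vecEquiv m (E k) := by
    rw [orthonormal_iff_ite]
    intro k l
    rw [inner_vecEquiv, trace_mul_conjTranspose_eq_hsInner (hE.1 l) (hE.1 k), hsInner, hE.2 l k]
    split_ifs <;> simp_all
  have hspan : ⊤ ≤ Submodule.span ℂ (Set.range fun k => vecEquiv m (E k)) := by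
    refine (hon.linearIndependent.span_eq_top_of_card_eq_finrank' ?_).ge
    simp [sq]
  apply (vecEquiv m).injective
  have h := (OrthonormalBasis.mk hon hspan).sum_repr' (vecEquiv m A)
  simpa [inner_vecEquiv] using h

lemma convex_densities_s13 {A B : Mat m} (hA : IsDensity A) (hB : IsDensity B) {t : ℝ}
    (h0 : 0 ≤ t) (h1 : t ≤ 1) : IsDensity (A + t • (B - A)) := by
  have h : A + t • (B - A) = (1 - t) • A + t • B := by
    rw [smul_sub, sub_smul, one_smul]; abel
  refine ⟨?_, ?_⟩
  · rw [h]
    exact (hA.1.smul (sub_nonneg.mpr h1)).add (hB.1.smul h0)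
  · simp [hA.2, hB.2]

lemma frob_le_one {A : Mat m} (hA : IsDensity A) : frob A ≤ 1 := by
  have hdiag : ∑ i, (A i i).re = 1 := by
    simpa [trace] using congrArg Complex.re hA.2
  have hminor (i j : Fin m) : ‖A i j‖ ^ 2 ≤ (A i i).re * (A j j).re := by
    have h := (hA.1.submatrix ![i, j]).det_nonneg
    rw [det_fin_two] at h
    have hji : A j i = star (A i j) := (hA.1.isHermitian.apply j i).symm
    have hii : (A i i).im = 0 := Complex.conj_eq_iff_im.mp (hA.1.isHermitian.apply i i)
    have h' := (Complex.le_def.mp h).1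
    simp [hji, hii] at h'
    rw [← Complex.normSq_eq_norm_sq, Complex.normSq_apply]
    linarith
  rw [frob, Real.sqrt_le_one]
  calc ∑ i, ∑ j, ‖A i j‖ ^ 2 ≤ ∑ i, ∑ j, (A i i).re * (A j j).re :=
        Finset.sum_le_sum fun i _ => Finset.sum_le_sum fun j _ => hminor i j
    _ = 1 := by rw [← Finset.sum_mul_sum, hdiag, one_mul]

lemma nonneg_of_forall_quadratic_nonneg {a b : ℝ}
    (h : ∀ t : ℝ, 0 < t → t ≤ 1 → 0 ≤ a * t + b * t ^ 2) : 0 ≤ a := by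
  have hlim : Filter.Tendsto (fun t : ℝ => a + b * t) (nhdsWithin 0 (Set.Ioi 0)) (nhds a) := by
    have : Continuous fun t : ℝ => a + b * t := by fun_prop
    simpa using (this.tendsto 0).mono_left nhdsWithin_le_nhds
  refine ge_of_tendsto hlim ?_
  filter_upwards [Ioc_mem_nhdsGT (zero_lt_one (α := ℝ))] with t ht
  have := h t ht.1 ht.2
  have h2 : 0 ≤ t * (a + b * t) := by linarith
  exact nonneg_of_mul_nonneg_right h2 ht.1

/-- Variational inequality for the projection onto the density matrices. -/
lemma IsProjOn.hsInner_le_zero {Z P S : Mat m} (hP : IsProjOn (Densities m) Z P)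
    (hS : IsDensity S) : hsInner (Z - P) (S - P) ≤ 0 := by
  have key : 0 ≤ -2 * hsInner (Z - P) (S - P) := by
    refine nonneg_of_forall_quadratic_nonneg (b := hsInner (S - P) (S - P)) fun t h0 h1 => ?_
    have h := pow_le_pow_left₀ (Real.sqrt_nonneg _)
      (hP.2 _ (convex_densities_s13 hP.1 hS h0.le h1)) 2
    change frob _ ^ 2 ≤ frob _ ^ 2 at h
    have hexp : frob (Z - (P + t • (S - P))) ^ 2 = hsInner (Z - P) (Z - P)
        - 2 * t * hsInner (Z - P) (S - P) + t ^ 2 * hsInner (S - P) (S - P) := by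
      rw [← sub_sub, frob_sq]
      generalize Z - P = U
      generalize S - P = V
      rw [hsInner_sub_left, hsInner_comm U, hsInner_smul_left, hsInner_comm V, hsInner_sub_left,
        hsInner_sub_left, hsInner_smul_left, hsInner_smul_left, hsInner_comm V U]
      ring
    rw [hexp, frob_sq] at h
    linarith
  linarith

/-- Variational inequality for a least squares estimator over the density matrices. -/
lemma leastSquares_hsInner_le_zero {n : ℕ} {X : Fin n → Mat m} {Y : Fin n → ℝ} {R S : Mat m}
    (hR : IsDensity R) (hmin : ∀ S : Mat m, IsDensity S →
      (∑ j, (Y j - hsInner R (X j)) ^ 2) ≤ ∑ j, (Y j - hsInner S (X j)) ^ 2)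
    (hS : IsDensity S) :
    ∑ j, (Y j - hsInner R (X j)) * hsInner (S - R) (X j) ≤ 0 := by
  have key : 0 ≤ -2 * ∑ j, (Y j - hsInner R (X j)) * hsInner (S - R) (X j) := by
    refine nonneg_of_forall_quadratic_nonneg
      (b := ∑ j, hsInner (S - R) (X j) ^ 2) fun t h0 h1 => ?_
    have h := hmin _ (convex_densities_s13 hR hS h0.le h1)
    rw [← sub_nonneg, ← Finset.sum_sub_distrib] at h
    refine h.trans_eq ?_
    rw [Finset.mul_sum, Finset.sum_mul, Finset.sum_mul, ← Finset.sum_add_distrib]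
    refine Finset.sum_congr rfl fun j _ => ?_
    rw [hsInner_add_left, hsInner_smul_left]
    ring
  linarith

lemma bddAbove_frob_image (L : Mat m →ₗ[ℂ] Mat m) :
    BddAbove {x : ℝ | ∃ C : Mat m, frob C ≤ 1 ∧ x = frob (L C)} := by
  let M := LinearMap.toContinuousLinearMap
    ((vecEquiv m).toLinearMap ∘ₗ L ∘ₗ (vecEquiv m).symm.toLinearMap)
  refine ⟨‖M‖, ?_⟩
  rintro _ ⟨C, hC, rfl⟩
  have h := M.le_opNorm (vecEquiv m C)
  have hM : M (vecEquiv m C) = vecEquiv m (L C) := by simp [M]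
  rw [hM, norm_vecEquiv, norm_vecEquiv] at h
  exact h.trans (mul_le_of_le_one_right (norm_nonneg _) hC)

/-- Deterministic comparison of the minimal distance estimator `ρ̌` and a
least squares estimator `ρ̂`: `‖ρ̌ - ρ̂‖₂ ≤ m² ‖(1/n) ∑ X_j ⊗ X_j - (1/m²) ∑ E_k ⊗ E_k‖_op`,
where `(A ⊗ B) C = A ⟨C,B⟩` and the operator norm of a map on matrices (with the
Hilbert–Schmidt norm) is the supremum of `‖L C‖₂` over the unit ball `‖C‖₂ ≤ 1`. -/
theorem stmt13 {m n : ℕ} (E : Fin (m ^ 2) → Mat m) (hE : IsONBasis E)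
    (X : Fin n → Mat m) (hX : ∀ j, ∃ k, X j = E k)
    (Y : Fin n → ℝ)
    (Zhat : Mat m) (hZhat : Zhat = (((m : ℝ) ^ 2) / n) • ∑ j, Y j • X j)
    (ρcheck : Mat m) (hρcheck : IsProjOn (Densities m) Zhat ρcheck)
    (ρhat : Mat m)
    (hρhat : IsDensity ρhat ∧ ∀ S : Mat m, IsDensity S →
      (∑ j, (Y j - hsInner ρhat (X j)) ^ 2) ≤ ∑ j, (Y j - hsInner S (X j)) ^ 2)
    (L : Mat m → Mat m)
    (hL : ∀ C : Mat m, L C =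
      ((n : ℂ))⁻¹ • ∑ j, (Matrix.trace (C * (X j)ᴴ)) • X j
        - (((m : ℂ)) ^ 2)⁻¹ • ∑ k, (Matrix.trace (C * (E k)ᴴ)) • E k) :
    frob (ρcheck - ρhat) ≤
      (m : ℝ) ^ 2 * sSup {x : ℝ | ∃ C : Mat m, frob C ≤ 1 ∧ x = frob (L C)} := by
  have hm : (m : ℂ) ^ 2 ≠ 0 := by
    rcases Nat.eq_zero_or_pos m with rfl | hm
    · simpa [trace] using hρhat.1.2
    · exact pow_ne_zero _ (Nat.cast_ne_zero.mpr hm.ne')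
  have hXh (j : Fin n) : (X j).IsHermitian := by
    obtain ⟨k, hk⟩ := hX j
    exact hk ▸ hE.1 k
  have hLlin : IsLinearMap ℂ L := by
    constructor
    · intro A B
      simp only [hL, add_mul, trace_add, add_smul, Finset.sum_add_distrib, smul_add]
      abel
    · intro c A
      simp only [hL, smul_mul_assoc, trace_smul, smul_sub, Finset.smul_sum, smul_smul, smul_eq_mul]
      simp only [mul_left_comm c]
  have hLle : frob (L ρhat) ≤ sSup {x : ℝ | ∃ C : Mat m, frob C ≤ 1 ∧ x = frob (L C)} :=
    le_csSup (bddAbove_frob_image hLlin.mk') ⟨ρhat, frob_le_one hρhat.1, rfl⟩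
  have hLρ : (m : ℝ) ^ 2 • L ρhat =
      ((m : ℝ) ^ 2 / n) • ∑ j, hsInner ρhat (X j) • X j - ρhat := by
    have hcast (c : ℝ) (A : Mat m) : c • A = (c : ℂ) • A := (Complex.coe_smul c A).symm
    rw [hL, hE.sum_trace_smul, hcast, hcast]
    simp only [hcast, trace_mul_conjTranspose_eq_hsInner hρhat.1.1.isHermitian (hXh _)]
    rw [smul_sub, smul_smul, smul_smul]
    push_cast
    rw [mul_inv_cancel₀ hm, one_smul, div_eq_mul_inv]
  set D := ρcheck - ρhat with hD
  have hls := leastSquares_hsInner_le_zero hρhat.1 hρhat.2 hρcheck.1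
  have hproj := hρcheck.hsInner_le_zero hρhat.1
  have hmain : hsInner D D ≤ (m : ℝ) ^ 2 * hsInner (L ρhat) D := by
    have h1 : hsInner (Zhat - ρcheck) D ≥ 0 := by
      have : ρhat - ρcheck = (-1 : ℝ) • D := by rw [hD]; simp
      rw [this, hsInner_comm, hsInner_smul_left, hsInner_comm] at hproj
      linarith
    have h2 : hsInner (Zhat - ((m : ℝ) ^ 2 / n) • ∑ j, hsInner ρhat (X j) • X j) D ≤ 0 := by
      rw [hZhat, ← smul_sub, ← Finset.sum_sub_distrib, hsInner_smul_left, hsInner_sum_left]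
      refine mul_nonpos_of_nonneg_of_nonpos (by positivity) (hls.trans_eq' ?_)
      refine Finset.sum_congr rfl fun j _ => ?_
      rw [← sub_smul, hsInner_smul_left, hsInner_comm (X j)]
    rw [← hsInner_smul_left, hLρ]
    nth_rewrite 1 [hD]
    simp only [hsInner_sub_left] at h1 h2 ⊢
    linarith
  have hcs := hsInner_le_frob_mul_frob (L ρhat) D
  have hD0 : 0 ≤ frob D := Real.sqrt_nonneg _
  have hbound : frob D ≤ (m : ℝ) ^ 2 * frob (L ρhat) := by
    rcases hD0.eq_or_lt with h | h
    · rw [← h]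
      exact mul_nonneg (by positivity) (Real.sqrt_nonneg _)
    · refine le_of_mul_le_mul_right ?_ h
      calc frob D * frob D = hsInner D D := by rw [← frob_sq, sq]
        _ ≤ (m : ℝ) ^ 2 * hsInner (L ρhat) D := hmain
        _ ≤ (m : ℝ) ^ 2 * (frob (L ρhat) * frob D) := by gcongr
        _ = _ := by ring
  exact hbound.trans (by gcongr)


end QST
end
end
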